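/- Let θ₁ : {a,b} → {0,1}⁺ be given by θ₁(a) = 1001, θ₁(b) = 1010, and let η : {a,b} → {a,b}⁺ be given by η(a) = aab, η(b) = abb. Let X ⊆ {0,1}^ℤ be the set of all sequences each of whose finite subwords occurs in θ₁(η^k(a)) for some k ∈ ℕ, and let σ be the shift on X. Let A = {x ∈ X : (x_0,…,x_11) = 100110011010} and B = {x ∈ X : (x_0,…,x_11) = 100110101010}, and define p : X → {1,2,3} by p(x) = 2 if x ∈ σ^j(A ∪ B) for some j ∈ {0,1,4,5,8,9}, p(x) = 3 if x ∈ σ^j(A ∪ B) for some j ∈ {2,6,10}, and p(x) = 1 if x ∈ σ^j(A ∪ B) for some j ∈ {3,7,11}. Then: the sets σ^j(A ∪ B), 0 ≤ j ≤ 11, partition X, so p is well defined and continuous; S(x) = σ^{p(x)}(x) is a homeomorphism of X with every S-orbit dense; every σ-orbit in X is the union of exactly 2 distinct S-orbits; (X,S) is topologically conjugate to the closure of the σ-orbit of some Toeplitz sequence over some finite alphabet (so (X,S) is a Toeplitz flow); and σ² : X → X is not minimal, so that in particular (X,S) is not topologically conjugate to (X, σ²). -/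

import Mathlib

open Set Topology Classical

noncomputable section

/-- The left shift `σ` on bi-infinite sequences: `(σ x) n = x (n+1)`. -/
def shiftMap {A : Type} (x : ℤ → A) : ℤ → A := fun n => x (n + 1)

/-- The shift by an integer amount: `shiftZ n x = σ^n x`. -/
def shiftZ {A : Type} (n : ℤ) (x : ℤ → A) : ℤ → A := fun m => x (m + n)

/-- A bi-infinite sequence is Toeplitz if every coordinate is periodically repeated. -/
def IsToeplitz {A : Type} (x : ℤ → A) : Prop :=
  ∀ i : ℤ, ∃ p : ℕ, 0 < p ∧ ∀ k : ℤ, x (i + k * (p : ℤ)) = x i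

/-- The closure of the full shift orbit of `x`. -/
def orbitClosure {A : Type} [TopologicalSpace A] (x : ℤ → A) : Set (ℤ → A) :=
  closure {y | ∃ n : ℤ, shiftZ n x = y}

/-- The finite word `x_i x_{i+1} ⋯ x_{i+n-1}`. -/
def seqWord {A : Type} (x : ℤ → A) (i : ℤ) (n : ℕ) : List A :=
  List.ofFn fun m : Fin n => x (i + (m : ℕ))

/-- Iterates `θ^k` of a substitution, applied to a letter. -/
def substPow {A : Type} (θ : A → List A) : ℕ → A → List A
  | 0, a => [a]
  | k + 1, a => (θ a).flatMap (substPow θ k)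

/-- The substitution subshift of `θ`: all sequences whose finite subwords occur in
some `θ^k(a)`. -/
def substShift {A : Type} (θ : A → List A) : Set (ℤ → A) :=
  {x | ∀ i : ℤ, ∀ n : ℕ, ∃ (k : ℕ) (a : A), (seqWord x i n).IsInfix (substPow θ k a)}

/-- The full orbit of `x` under an (invertible) map `S`, within the set `X`. -/
def orbitIn {α : Type} (S : α → α) (X : Set α) (x : α) : Set α :=
  {y | y ∈ X ∧ ∃ n : ℕ, S^[n] x = y ∨ S^[n] y = x}

/-- Every `S`-orbit within `X` is dense in `X`. -/
def MinimalOn {α : Type} [TopologicalSpace α] (S : α → α) (X : Set α) : Prop :=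
  ∀ x ∈ X, X ⊆ closure (orbitIn S X x)

/-- Every `T`-orbit in `X` is the union of exactly `c` distinct `S`-orbits. -/
def OrbitNumberOn {α : Type} (T S : α → α) (X : Set α) (c : ℕ) : Prop :=
  ∀ x ∈ X, ∃ r : Fin c → α,
    (∀ i, r i ∈ orbitIn T X x) ∧
    (∀ i j, i ≠ j → r j ∉ orbitIn S X (r i)) ∧
    (∀ y ∈ orbitIn T X x, ∃ i, y ∈ orbitIn S X (r i))

/-- `S` restricts to a homeomorphism of the subset `X`. -/
def RestrictsToHomeomorph {α : Type} [TopologicalSpace α] (S : α → α) (X : Set α) : Prop :=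
  ∃ e : X ≃ₜ X, ∀ x : X, (e x : α) = S (x : α)

/-- The systems `(X, S)` and `(Y, R)` are topologically conjugate. -/
def TopConj {α β : Type} [TopologicalSpace α] [TopologicalSpace β]
    (X : Set α) (S : α → α) (Y : Set β) (R : β → β) : Prop :=
  ∃ (hS : Set.MapsTo S X X) (hR : Set.MapsTo R Y Y) (h : X ≃ₜ Y),
    ∀ x : X, h (Set.MapsTo.restrict S X X hS x) = Set.MapsTo.restrict R Y Y hR (h x)

/-- `(Y, R)` is a topological factor of `(X, S)`. -/
def IsFactorOn {α β : Type} [TopologicalSpace α] [TopologicalSpace β]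
    (X : Set α) (S : α → α) (Y : Set β) (R : β → β) : Prop :=
  ∃ F : α → β, Set.MapsTo F X Y ∧ ContinuousOn F X ∧ Set.SurjOn F X Y ∧
    ∀ x ∈ X, F (S x) = R (F x)

/-- `(X, S)` is a Toeplitz flow: it is topologically conjugate to the orbit closure of
some Toeplitz sequence over some finite alphabet, with the shift map. -/
def IsToeplitzFlow {α : Type} [TopologicalSpace α] (X : Set α) (S : α → α) : Prop :=
  ∃ (B : Type) (_ : Fintype B) (z : ℤ → B), IsToeplitz z ∧
    (letI : TopologicalSpace B := ⊥
     TopConj X S (orbitClosure z) shiftMap)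

/-- `Per_p(x)`: the set of positions where `x` is periodic with period `p`. -/
def PerSet {A : Type} (x : ℤ → A) (p : ℕ) : Set ℤ :=
  {k | ∀ n : ℤ, x (k + n * (p : ℤ)) = x k}

/-- `p` is an essential period of `x`. -/
def IsEssentialPeriod {A : Type} (x : ℤ → A) (p : ℕ) : Prop :=
  0 < p ∧ ¬ ∃ q : ℕ, 0 < q ∧ q < p ∧
    ((fun k => k + (q : ℤ)) '' PerSet x p = PerSet x p) ∧
    (∀ k ∈ PerSet x p, x (k + (q : ℤ)) = x k)

/-- A period structure for a Toeplitz sequence `x`. -/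
def IsPeriodStructure {A : Type} (x : ℤ → A) (p : ℕ → ℕ) : Prop :=
  StrictMono p ∧ (∀ k, IsEssentialPeriod x (p k)) ∧
  (∀ k, p k ∣ p (k + 1)) ∧ (⋃ k, PerSet x (p k)) = Set.univ

/-- `x` is a (σ-)periodic sequence. -/
def IsPeriodicSeq {A : Type} (x : ℤ → A) : Prop :=
  ∃ n : ℕ, 0 < n ∧ ∀ m : ℤ, x (m + (n : ℤ)) = x m

/-- `z` is the bi-infinite concatenation of the `ψ`-images of the letters of `y`,
with `ψ(y₀)` beginning at coordinate `0`. -/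
def IsConcat {B C : Type} (ψ : B → List C) (y : ℤ → B) (z : ℤ → C) : Prop :=
  ∃ s : ℤ → ℤ, s 0 = 0 ∧
    (∀ n : ℤ, s (n + 1) = s n + ((ψ (y n)).length : ℤ)) ∧
    (∀ n : ℤ, ∀ j : Fin (ψ (y n)).length, z (s n + (j : ℕ)) = (ψ (y n)).get j)

/-- `p(x,n) = Σ_{i<n} p(Sⁱ x)`. -/
def psum {X : Type} (p : X → ℕ) (S : X → X) (x : X) (n : ℕ) : ℕ :=
  ∑ i ∈ Finset.range n, p (S^[i] x)


/-- θ₁(a) = 1001, θ₁(b) = 1010 on {0,1}. -/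
def theta1 : Fin 2 → List (Fin 2) := fun i => if i = 0 then [1, 0, 0, 1] else [1, 0, 1, 0]

/-- η(a) = aab, η(b) = abb on {a,b} = Fin 2. -/
def eta : Fin 2 → List (Fin 2) := fun i => if i = 0 then [0, 0, 1] else [0, 1, 1]

/-- X: all sequences whose finite subwords occur in θ₁(ηᵏ(a)) for some k. -/
def X18 : Set (ℤ → Fin 2) :=
  {x | ∀ i : ℤ, ∀ n : ℕ, ∃ k : ℕ,
    (seqWord x i n).IsInfix ((substPow eta k 0).flatMap theta1)}

/-- A = {x ∈ X : x₀…x₁₁ = 100110011010}. -/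
def Aset18 : Set (ℤ → Fin 2) :=
  {x | x ∈ X18 ∧ seqWord x 0 12 = [1, 0, 0, 1, 1, 0, 0, 1, 1, 0, 1, 0]}

/-- B = {x ∈ X : x₀…x₁₁ = 100110101010}. -/
def Bset18 : Set (ℤ → Fin 2) :=
  {x | x ∈ X18 ∧ seqWord x 0 12 = [1, 0, 0, 1, 1, 0, 1, 0, 1, 0, 1, 0]}

open scoped Classical in
/-- The jump function: p = 2 on σʲ(A ∪ B) for j ∈ {0,1,4,5,8,9}, p = 3 for
j ∈ {2,6,10}, and p = 1 for j ∈ {3,7,11}. -/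
noncomputable def jump18 (x : ℤ → Fin 2) : ℕ :=
  if ∃ j ∈ ({0, 1, 4, 5, 8, 9} : Set ℕ), x ∈ shiftMap^[j] '' (Aset18 ∪ Bset18) then 2
  else if ∃ j ∈ ({2, 6, 10} : Set ℕ), x ∈ shiftMap^[j] '' (Aset18 ∪ Bset18) then 3
  else 1

/-- The speedup map S(x) = σ^{p(x)}(x). -/
noncomputable def S18 (x : ℤ → Fin 2) : ℤ → Fin 2 := shiftMap^[jump18 x] x

/-- The Toeplitz fixed point of `eta`. -/
def uu (n : ℤ) : Fin 2 :=
  if h0 : n % 3 = 0 then 0 else if h2 : n % 3 = 2 then 1 else uu (n / 3)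
termination_by n.natAbs
decreasing_by omega

theorem uu_zero (n : ℤ) : uu (3 * n) = 0 := by
  rw [uu, dif_pos (by omega)]

theorem uu_two (n : ℤ) : uu (3 * n + 2) = 1 := by
  rw [uu, dif_neg (by omega), dif_pos (by omega)]

theorem uu_one (n : ℤ) : uu (3 * n + 1) = uu n := by
  rw [uu, dif_neg (by omega), dif_neg (by omega)]
  congr 1; omega

/-- The image of `uu` under `theta1`. -/
def vv (m : ℤ) : Fin 2 :=
  if m % 4 = 0 then 1 else if m % 4 = 1 then 0
  else if m % 4 = 2 then uu (m / 4) else 1 - uu (m / 4)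

theorem vv0 (n m : ℤ) (h : m = 4 * n) : vv m = 1 := by
  rw [vv, if_pos (by omega)]
theorem vv1 (n m : ℤ) (h : m = 4 * n + 1) : vv m = 0 := by
  rw [vv, if_neg (by omega), if_pos (by omega)]
theorem vv2 (n m : ℤ) (h : m = 4 * n + 2) : vv m = uu n := by
  rw [vv, if_neg (by omega), if_neg (by omega), if_pos (by omega)]
  congr 1; omega
theorem vv3 (n m : ℤ) (h : m = 4 * n + 3) : vv m = 1 - uu n := by
  rw [vv, if_neg (by omega), if_neg (by omega), if_neg (by omega)]
  congr 2; omega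

theorem uu_toep (b : ℤ) : ∃ k : ℕ, ∀ K : ℕ, k ≤ K → ∀ q : ℤ, uu (b + 3 ^ K * q) = uu b := by
  induction hn : b.natAbs using Nat.strong_induction_on generalizing b with
  | _ n ih =>
    have h3 : b % 3 = 0 ∨ b % 3 = 1 ∨ b % 3 = 2 := by omega
    rcases h3 with h | h | h
    · refine ⟨1, fun K hK q => ?_⟩
      obtain ⟨K, rfl⟩ := Nat.exists_eq_add_of_le hK
      obtain ⟨c, rfl⟩ : ∃ c, b = 3 * c := ⟨b / 3, by omega⟩
      rw [show 3 * c + 3 ^ (1 + K) * q = 3 * (c + 3 ^ K * q) by ring, uu_zero, uu_zero]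
    · obtain ⟨c, rfl⟩ : ∃ c, b = 3 * c + 1 := ⟨b / 3, by omega⟩
      obtain ⟨k, hk⟩ := ih c.natAbs (by omega) c rfl
      refine ⟨k + 1, fun K hK q => ?_⟩
      obtain ⟨K, rfl⟩ := Nat.exists_eq_add_of_le hK
      rw [show 3 * c + 1 + 3 ^ (k + 1 + K) * q = 3 * (c + 3 ^ (k + K) * q) + 1 by ring, uu_one,
        uu_one, hk _ (by omega)]
    · refine ⟨1, fun K hK q => ?_⟩
      obtain ⟨K, rfl⟩ := Nat.exists_eq_add_of_le hK
      obtain ⟨c, rfl⟩ : ∃ c, b = 3 * c + 2 := ⟨b / 3, by omega⟩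
      rw [show 3 * c + 2 + 3 ^ (1 + K) * q = 3 * (c + 3 ^ K * q) + 2 by ring, uu_two, uu_two]

theorem vv_toep1 (m : ℤ) : ∃ k : ℕ, ∀ K : ℕ, k ≤ K → ∀ q : ℤ,
    vv (m + 4 * 3 ^ K * q) = vv m := by
  obtain ⟨k, hk⟩ := uu_toep (m / 4)
  refine ⟨k, fun K hK q => ?_⟩
  have h := hk K hK q
  have e : m + 4 * 3 ^ K * q = m + 4 * (3 ^ K * q) := by ring
  rw [e]
  generalize 3 ^ K * q = w at *
  have e1 : (m + 4 * w) % 4 = m % 4 := by omega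
  have e2 : (m + 4 * w) / 4 = m / 4 + w := by omega
  rw [vv, vv, e1, e2, h]

theorem vv_toep (m : ℤ) (N : ℕ) : ∃ k : ℕ, ∀ K : ℕ, k ≤ K → ∀ q t : ℤ, -N ≤ t → t ≤ N →
    vv (m + t + 4 * 3 ^ K * q) = vv (m + t) := by
  induction N with
  | zero =>
    obtain ⟨k, hk⟩ := vv_toep1 m
    refine ⟨k, fun K hK q t h1 h2 => ?_⟩
    obtain rfl : t = 0 := by simp at h1 h2; omega
    rw [add_zero]; exact hk K hK q
  | succ N ih =>
    obtain ⟨k, hk⟩ := ih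
    obtain ⟨k1, hk1⟩ := vv_toep1 (m + (N + 1))
    obtain ⟨k2, hk2⟩ := vv_toep1 (m + -(N + 1))
    refine ⟨max k (max k1 k2), fun K hK q t h1 h2 => ?_⟩
    push_cast at h1 h2
    by_cases ha : t = N + 1
    · subst ha; exact hk1 K (by omega) q
    by_cases hb : t = -(N + 1)
    · subst hb; exact hk2 K (by omega) q
    exact hk K (by omega) q t (by omega) (by omega)

/-- Aperiodicity of `uu`. -/
theorem uu_aper (k : ℕ) : ∀ (d lo : ℤ), (∀ b, lo ≤ b → b < lo + 3 ^ k → uu (b + d) = uu b) →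
    (3 : ℤ) ^ k ∣ d := by
  induction k with
  | zero => intro d lo _; simp
  | succ k ih =>
    intro d lo h
    have hpos : (0 : ℤ) < 3 ^ k := by positivity
    rw [pow_succ] at h
    have h3 : d % 3 = 0 ∨ d % 3 = 1 ∨ d % 3 = 2 := by omega
    rcases h3 with h3 | h3 | h3
    · obtain ⟨d', rfl⟩ : ∃ c, d = 3 * c := ⟨d / 3, by omega⟩
      rw [pow_succ, mul_comm]
      refine mul_dvd_mul_left 3 (ih d' ((lo + 1) / 3) ?_)
      intro b h1 h2
      have := h (3 * b + 1) (by omega) (by omega)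
      rwa [show 3 * b + 1 + 3 * d' = 3 * (b + d') + 1 by ring, uu_one, uu_one] at this
    · exfalso
      have := h (3 * (lo / 3) + 2 ) 
      have := h (3 * (lo / 3) + 2) (by omega) (by omega)
      rw [uu_two, show 3 * (lo / 3) + 2 + d = 3 * (lo / 3 + d / 3 + 1) by omega, uu_zero] at this
      simp at this
    · exfalso
      have := h (3 * ((lo + 2) / 3)) (by omega) (by omega)
      rw [uu_zero, show 3 * ((lo + 2) / 3) + d = 3 * ((lo + 2) / 3 + d / 3) + 2 by omega,
        uu_two] at this
      simp at this

/-- An `A`- or `B`-word occurs at position `p`. -/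
def isAB (x : ℤ → Fin 2) (p : ℤ) : Prop :=
  x p = 1 ∧ x (p + 1) = 0 ∧ x (p + 2) = 0 ∧ x (p + 3) = 1 ∧ x (p + 4) = 1 ∧ x (p + 5) = 0 ∧
  x (p + 7) = 1 - x (p + 6) ∧ x (p + 8) = 1 ∧ x (p + 9) = 0 ∧ x (p + 10) = 1 ∧ x (p + 11) = 0

theorem vv_period (q : ℤ) : isAB vv (12 * q) := by
  refine ⟨?_, ?_, ?_, ?_, ?_, ?_, ?_, ?_, ?_, ?_, ?_⟩
  · exact vv0 (3 * q) _ (by ring)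
  · exact vv1 (3 * q) _ (by ring)
  · rw [vv2 (3 * q) _ (by ring), uu_zero]
  · rw [vv3 (3 * q) _ (by ring), uu_zero]; rfl
  · exact vv0 (3 * q + 1) _ (by ring)
  · exact vv1 (3 * q + 1) _ (by ring)
  · rw [vv3 (3 * q + 1) _ (by ring), vv2 (3 * q + 1) _ (by ring)]
  · exact vv0 (3 * q + 2) _ (by ring)
  · exact vv1 (3 * q + 2) _ (by ring)
  · rw [vv2 (3 * q + 2) _ (by ring), uu_two]
  · rw [vv3 (3 * q + 2) _ (by ring), uu_two]; rfl

theorem isAB_vv (m : ℤ) (h : isAB vv m) : m % 12 = 0 := by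
  obtain ⟨h0, h1, h2, h3, h4, h5, h7, h8, h9, h10, h11⟩ := h
  have hm : m % 4 = 0 := by
    by_contra hne
    have h4 : m % 4 = 1 ∨ m % 4 = 2 ∨ m % 4 = 3 := by omega
    rcases h4 with h | h | h
    · rw [vv1 (m / 4) m (by omega)] at h0; simp at h0
    · rw [vv0 (m / 4 + 1) (m + 2) (by omega)] at h2; simp at h2
    · rw [vv0 (m / 4 + 1) (m + 1) (by omega)] at h1; simp at h1
  obtain ⟨b, rfl⟩ : ∃ b, m = 4 * b := ⟨m / 4, by omega⟩
  rw [vv2 b _ (by ring)] at h2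
  rw [vv2 (b + 2) _ (by ring)] at h10
  have h3 : b % 3 = 0 ∨ b % 3 = 1 ∨ b % 3 = 2 := by omega
  rcases h3 with h | h | h
  · omega
  · obtain ⟨c, rfl⟩ : ∃ c, b = 3 * c + 1 := ⟨b / 3, by omega⟩
    rw [show 3 * c + 1 + 2 = 3 * (c + 1) by ring, uu_zero] at h10
    simp at h10
  · obtain ⟨c, rfl⟩ : ∃ c, b = 3 * c + 2 := ⟨b / 3, by omega⟩
    rw [uu_two] at h2
    simp at h2

/-- `x` coincides on `[-N, N]` with `vv` around position `m`. -/
def Mt (x : ℤ → Fin 2) (N m : ℤ) : Prop := ∀ t, -N ≤ t → t ≤ N → x t = vv (m + t)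

theorem isAB_Mt {x : ℤ → Fin 2} {N m : ℤ} (h : Mt x N m) (hN : 24 ≤ N) (p : ℤ) (h1 : -12 ≤ p)
    (h2 : p ≤ 12) : isAB x p ↔ (m + p) % 12 = 0 := by
  have key : isAB x p ↔ isAB vv (m + p) := by
    unfold isAB
    simp only [add_assoc]
    rw [h p (by omega) (by omega), h (p + 1) (by omega) (by omega), h (p + 2) (by omega) (by omega),
      h (p + 3) (by omega) (by omega), h (p + 4) (by omega) (by omega),
      h (p + 5) (by omega) (by omega), h (p + 6) (by omega) (by omega),
      h (p + 7) (by omega) (by omega), h (p + 8) (by omega) (by omega),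
      h (p + 9) (by omega) (by omega), h (p + 10) (by omega) (by omega),
      h (p + 11) (by omega) (by omega)]
  rw [key]
  refine ⟨isAB_vv _, fun hh => ?_⟩
  have := vv_period ((m + p) / 12)
  rwa [show 12 * ((m + p) / 12) = m + p by omega] at this

theorem Mt_unique {x : ℤ → Fin 2} {N N' m m' : ℤ} (hN : 24 ≤ N) (hN' : 24 ≤ N')
    (h : Mt x N m) (h' : Mt x N' m') : m % 12 = m' % 12 := by
  have h1 := isAB_Mt h hN (-(m % 12)) (by omega) (by omega)
  have h2 := isAB_Mt h' hN' (-(m % 12)) (by omega) (by omega)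
  rw [h1] at h2
  have := h2.1 (by omega)
  omega

theorem Mt_mono {x : ℤ → Fin 2} {N N' m : ℤ} (hN : N' ≤ N) (h : Mt x N m) : Mt x N' m :=
  fun t h1 h2 => h t (by omega) (by omega)

theorem Mt_shift {x : ℤ → Fin 2} {N m d : ℤ} (L : ℤ) (h : Mt x L m) (h1 : N + d ≤ L)
    (h2 : N - d ≤ L) : Mt (shiftZ d x) N (m + d) := by
  intro t ht1 ht2
  rw [shiftZ, h (t + d) (by omega) (by omega)]
  congr 1; ring

/-! Words -/

theorem seqWord_length {A : Type} (x : ℤ → A) (i : ℤ) (n : ℕ) : (seqWord x i n).length = n := by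
  simp [seqWord]

theorem seqWord_append {A : Type} (x : ℤ → A) (i : ℤ) (n m : ℕ) :
    seqWord x i (n + m) = seqWord x i n ++ seqWord x (i + n) m := by
  unfold seqWord
  rw [List.ofFn_add]
  congr 1
  congr 1
  funext k
  congr 1
  simp
  ring

theorem seqWord_eq_iff {A : Type} (x y : ℤ → A) (i j : ℤ) (n : ℕ) :
    seqWord x i n = seqWord y j n ↔ ∀ t : ℕ, t < n → x (i + t) = y (j + t) := by
  unfold seqWord
  rw [List.ofFn_inj, funext_iff]
  exact ⟨fun h t ht => h ⟨t, ht⟩, fun h t => h t t.2⟩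

theorem seqWord_infix_iff {A : Type} (x y : ℤ → A) (i j : ℤ) (n N : ℕ) :
    (seqWord x i n).IsInfix (seqWord y j N) ↔
      ∃ d : ℕ, d + n ≤ N ∧ ∀ t : ℕ, t < n → x (i + t) = y (j + d + t) := by
  constructor
  · rintro ⟨s, t, h⟩
    have hl := congrArg List.length h
    simp only [List.length_append, seqWord_length] at hl
    refine ⟨s.length, by omega, ?_⟩
    rw [← seqWord_eq_iff]
    have e : seqWord y j N = seqWord y j s.length ++ seqWord y (j + s.length) n ++
        seqWord y (j + s.length + n) t.length := by
      rw [← hl, seqWord_append, seqWord_append]; push_cast; simp [add_assoc]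
    rw [e] at h
    have h1 := List.append_inj_left h (by simp [seqWord_length])
    exact List.append_inj_right h1 (by simp [seqWord_length])
  · rintro ⟨d, hd, h⟩
    rw [← seqWord_eq_iff] at h
    rw [h]
    refine ⟨seqWord y j d, seqWord y (j + d + n) (N - (d + n)), ?_⟩
    conv_rhs => rw [show N = d + n + (N - (d + n)) by omega]
    rw [seqWord_append, seqWord_append]; push_cast; simp [add_assoc]

theorem seqWord_succ {A : Type} (x : ℤ → A) (i : ℤ) (n : ℕ) :
    seqWord x i (n + 1) = x i :: seqWord x (i + 1) n := by
  rw [add_comm, seqWord_append]; simp [seqWord]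

theorem seqWord_zero {A : Type} (x : ℤ → A) (i : ℤ) :
    seqWord x i 0 = [] := by simp [seqWord]

theorem eta_uu (b : ℤ) : eta (uu b) = [uu (3 * b), uu (3 * b + 1), uu (3 * b + 2)] := by
  rw [uu_zero, uu_one, uu_two]
  generalize uu b = c
  revert c; decide

theorem theta_uu (b : ℤ) : theta1 (uu b) = seqWord vv (4 * b) 4 := by
  simp only [seqWord_succ, seqWord_zero]
  rw [vv0 b _ rfl, vv1 b _ (by ring), vv2 b _ (by ring), vv3 b _ (by ring)]
  generalize uu b = c
  revert c; decide

theorem substPow_uu (k : ℕ) : ∀ b : ℤ, substPow eta k (uu b) = seqWord uu (b * 3 ^ k) (3 ^ k) := by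
  induction k with
  | zero => intro b; simp [substPow, seqWord]
  | succ k ih =>
    intro b
    rw [substPow, eta_uu]
    simp only [List.flatMap_cons, List.flatMap_nil, ih, List.append_nil]
    rw [show (3 : ℕ) ^ (k + 1) = 3 ^ k + (3 ^ k + 3 ^ k) by ring, seqWord_append, seqWord_append]
    push_cast
    congr 1
    · congr 1; ring
    · congr 1
      · congr 1; ring
      · congr 1; ring

theorem theta_seq (n : ℕ) : ∀ b : ℤ, (seqWord uu b n).flatMap theta1 = seqWord vv (4 * b) (4 * n) := by
  induction n with
  | zero => intro b; simp [seqWord_zero]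
  | succ n ih =>
    intro b
    rw [seqWord_succ, List.flatMap_cons, ih, theta_uu, show 4 * (n + 1) = 4 + 4 * n by ring,
      seqWord_append]
    congr 2
    push_cast; ring

theorem word_eq (k : ℕ) : (substPow eta k 0).flatMap theta1 = seqWord vv 0 (4 * 3 ^ k) := by
  have h : uu 0 = 0 := uu_zero 0
  have := substPow_uu k 0
  rw [h] at this
  rw [this, theta_seq]; simp

theorem mem_X_iff (x : ℤ → Fin 2) : x ∈ X18 ↔ ∀ N : ℕ, ∃ m, Mt x N m := by
  unfold X18
  simp only [mem_ofPred_eq, word_eq, seqWord_infix_iff]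
  constructor
  · intro h N
    obtain ⟨k, d, -, hd⟩ := h (-N) (2 * N + 1)
    refine ⟨d + N, fun t h1 h2 => ?_⟩
    have := hd (t + N).toNat (by omega)
    rw [Int.toNat_of_nonneg (by omega)] at this
    convert this using 2 <;> ring
  · intro h i n
    obtain ⟨m, hm⟩ := h (i.natAbs + n)
    obtain ⟨k, hk⟩ := vv_toep m (i.natAbs + n)
    have hk := hk k le_rfl (|m + i|)
    have hp : (1 : ℤ) ≤ 4 * 3 ^ k := by
      have : (1 : ℤ) ≤ 3 ^ k := one_le_pow₀ (by norm_num)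
      omega
    have hge : |m + i| ≤ 4 * 3 ^ k * |m + i| := by nlinarith [abs_nonneg (m + i)]
    have hge2 := neg_abs_le (m + i)
    generalize 4 * 3 ^ k * |m + i| = w at *
    have hlt : (m + i + w).toNat + n < 3 ^ ((m + i + w).toNat + n) :=
      Nat.lt_pow_self (by norm_num)
    refine ⟨(m + i + w).toNat + n, (m + i + w).toNat, by omega, ?_⟩
    intro t ht
    have e1 := hm (i + t) (by omega) (by omega)
    have e2 := hk (i + t) (by omega) (by omega)
    rw [e1, ← e2]
    congr 1
    omega

theorem vv_mem : vv ∈ X18 := by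
  rw [mem_X_iff]; intro N; exact ⟨0, fun t _ _ => by simp⟩

theorem shiftZ_mem {x : ℤ → Fin 2} (hx : x ∈ X18) (d : ℤ) : shiftZ d x ∈ X18 := by
  rw [mem_X_iff] at *
  intro N
  obtain ⟨m, hm⟩ := hx (N + d.natAbs)
  exact ⟨m + d, Mt_shift _ hm (by omega) (by omega)⟩

theorem X_aper {x : ℤ → Fin 2} (hx : x ∈ X18) {d : ℤ} (h : shiftZ d x = x) : d = 0 := by
  have hx := (mem_X_iff x).1 hx
  obtain ⟨k, hk⟩ : ∃ k : ℕ, d.natAbs < 3 ^ k := ⟨_, Nat.lt_pow_self (by norm_num)⟩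
  have hk3 : ((3 ^ k : ℕ) : ℤ) = (3 : ℤ) ^ k := by push_cast; rfl
  have hkn : ((3 : ℤ) ^ k).natAbs = 3 ^ k := by rw [← hk3]; rfl
  have hua := uu_aper k
  rw [← hk3] at hua hkn
  clear hk3
  generalize 3 ^ k = K at *
  obtain ⟨m, hm⟩ := hx (24 + d.natAbs + 4 * K + 8)
  have h1 := Mt_shift (N := 24) _ hm (d := d) (by omega) (by omega)
  rw [h] at h1
  have h12 := Mt_unique (by omega) (by omega) hm h1
  obtain ⟨e, rfl⟩ : ∃ e, d = 4 * e := ⟨d / 4, by omega⟩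
  have := hua e (m / 4 + 1) ?_
  · have := Int.eq_zero_of_dvd_of_natAbs_lt_natAbs this (by omega)
    omega
  · intro b hb1 hb2
    have e1 := hm (4 * b + 2 - m) (by omega) (by omega)
    have e2 := hm (4 * b + 2 - m + 4 * e) (by omega) (by omega)
    have e3 := congrFun h (4 * b + 2 - m)
    simp only [shiftZ] at e3
    rw [e3, e1, vv2 b _ (by ring), vv2 (b + e) _ (by ring)] at e2
    exact e2.symm

/-! The combinatorics of the jumps -/

/-- Carry term. -/
def ee (i : ℤ) : ℤ := if 2 ≤ i % 4 then 1 else 0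

/-- Position in the `S`-tower of a position mod 4. -/
def ii (m : ℤ) : ℤ := if m % 4 = 1 then 2 else if m % 4 = 2 then 1 else m % 4

/-- Displacement after `n` steps of `S`, starting at phase `m`. -/
def DD (m n : ℤ) : ℤ := 2 * n + ee (ii m + n) - ee (ii m)

theorem ii_congr {m m' : ℤ} (h : m % 4 = m' % 4) : ii m = ii m' := by
  unfold ii; rw [h]

theorem DD_congr {m m' : ℤ} (h : m % 4 = m' % 4) (n : ℤ) : DD m n = DD m' n := by
  unfold DD; rw [ii_congr h]

theorem ee_ii (m : ℤ) : ee (ii m) = m % 2 := by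
  unfold ee ii; split_ifs <;> omega

theorem ii_range (m : ℤ) : 0 ≤ ii m ∧ ii m < 4 := by
  unfold ii; split_ifs <;> omega

theorem ii_DD (m n : ℤ) : ii (m + DD m n) = (ii m + n) % 4 := by
  unfold DD ee ii; split_ifs <;> omega

theorem ee_mod (i : ℤ) : ee (i % 4) = ee i := by
  unfold ee; rw [Int.emod_emod_of_dvd _ (dvd_refl 4)]

theorem ee_range (i : ℤ) : 0 ≤ ee i ∧ ee i ≤ 1 := by
  unfold ee; split_ifs <;> omega

theorem DD_add (m a b : ℤ) : DD m (a + b) = DD m a + DD (m + DD m a) b := by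
  have h := ii_DD m a
  have e1 : ee (ii (m + DD m a) + b) = ee (ii m + (a + b)) := by
    rw [h, ← ee_mod, Int.emod_add_emod, ee_mod, add_assoc]
  have e2 : ee (ii (m + DD m a)) = ee (ii m + a) := by rw [h, ee_mod]
  have e3 : DD (m + DD m a) b = 2 * b + ee (ii m + (a + b)) - ee (ii m + a) := by
    rw [← e1, ← e2]; rfl
  rw [e3, DD, DD]; ring

theorem DD_zero (m : ℤ) : DD m 0 = 0 := by simp [DD]

theorem DD_add_four (m n q : ℤ) : DD m (n + 4 * q) = DD m n + 8 * q := by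
  unfold DD
  have : ee (ii m + (n + 4 * q)) = ee (ii m + n) := by
    rw [← ee_mod, ← ee_mod (ii m + n)]; congr 1; omega
  rw [this]; ring

theorem ii_inj {m m' : ℤ} (h : ii m = ii m') : m % 4 = m' % 4 := by
  unfold ii at h; split_ifs at h <;> omega

theorem DD_hit (m d : ℤ) : (∃ n, DD m n = d) ∨ (∃ n, DD m n = d - 4) := by
  have hn : DD m ((d - (m + d) % 2 + m % 2) / 2) = d ∨
      DD m ((d - (m + d) % 2 + m % 2) / 2 - 2) = d - 4 := by
    unfold DD ee ii; split_ifs <;> omega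
  rcases hn with h | h
  · exact Or.inl ⟨_, h⟩
  · exact Or.inr ⟨_, h⟩

theorem DD_ne_four (m n : ℤ) : DD m n ≠ 4 ∧ DD m n ≠ -4 := by
  unfold DD ee ii; split_ifs <;> omega

/-- Any residue class modulo `4 * 3 ^ k` is reached in bounded time. -/
theorem DD_reach (m m' : ℤ) (k : ℕ) : ∃ n : ℕ, (n : ℤ) < 4 * 3 ^ k + 4 ∧
    ∃ q, m + DD m n = m' + 4 * 3 ^ k * q := by
  set n0 : ℤ := (ii m' - ii m) % 4 with hn0
  have h1 : ii (m + DD m n0) = ii m' := by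
    rw [ii_DD, hn0]
    have := ii_range m'
    omega
  have h2 := ii_inj h1
  obtain ⟨w, hw⟩ : ∃ w, m + DD m n0 - m' = 4 * w := ⟨(m + DD m n0 - m') / 4, by omega⟩
  have hodd : Odd ((3 : ℤ) ^ k) := Odd.pow (by decide)
  obtain ⟨r, hr⟩ := hodd
  have hpos : (0 : ℤ) < 3 ^ k := by positivity
  have hq0 := Int.emod_nonneg (w * r) hpos.ne'
  have hq1 := Int.emod_lt_of_pos (w * r) hpos
  have hq2 := Int.mul_ediv_add_emod (w * r) (3 ^ k)
  set q := (w * r) % 3 ^ k with hq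
  refine ⟨(n0 + 4 * q).toNat, by omega, w - 2 * (w * r / 3 ^ k), ?_⟩
  rw [Int.toNat_of_nonneg (by omega), DD_add_four]
  have : q = w * r - 3 ^ k * (w * r / 3 ^ k) := by linarith
  have e : 4 * (3 : ℤ) ^ k * (w - 2 * (w * r / 3 ^ k)) = 4 * w * 3 ^ k - 8 * (3 ^ k * (w * r / 3 ^ k)) := by
    ring
  rw [e]
  have e2 : 4 * w * (3 : ℤ) ^ k = 4 * w + 8 * (w * r) := by rw [hr]; ring
  rw [e2]
  linarith

/-! Phases -/

/-- A position of `vv` around which `x` coincides with `vv`. -/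
def ph (x : ℤ → Fin 2) : ℤ := if h : ∃ m, Mt x 24 m then h.choose else 0

theorem ph_spec {x : ℤ → Fin 2} (hx : x ∈ X18) : Mt x 24 (ph x) := by
  have h : ∃ m, Mt x 24 m := by exact_mod_cast (mem_X_iff x).1 hx 24
  rw [ph, dif_pos h]; exact h.choose_spec

theorem ph_eq {x : ℤ → Fin 2} (hx : x ∈ X18) {N m : ℤ} (hN : 24 ≤ N) (h : Mt x N m) :
    ph x % 12 = m % 12 := Mt_unique le_rfl hN (ph_spec hx) h

theorem ph_shift {x : ℤ → Fin 2} (hx : x ∈ X18) (d : ℤ) :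
    ph (shiftZ d x) % 12 = (ph x + d) % 12 := by
  obtain ⟨m, hm⟩ := (mem_X_iff x).1 hx (24 + d.natAbs)
  have h1 := ph_eq hx (by omega) hm
  have h2 := ph_eq (shiftZ_mem hx d) le_rfl (Mt_shift (N := 24) (d := d) _ hm (by omega) (by omega))
  omega

theorem ph_congr {x y : ℤ → Fin 2} (hx : x ∈ X18) (hy : y ∈ X18)
    (h : ∀ t, -24 ≤ t → t ≤ 24 → y t = x t) : ph y % 12 = ph x % 12 := by
  refine ph_eq hy le_rfl (m := ph x) (fun t h1 h2 => ?_)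
  rw [h t h1 h2]; exact ph_spec hx t h1 h2

theorem shiftZ_shiftZ {A : Type} (x : ℤ → A) (a b : ℤ) : shiftZ a (shiftZ b x) = shiftZ (b + a) x := by
  funext t; simp only [shiftZ]; congr 1; ring

theorem shiftZ_zero' {A : Type} (x : ℤ → A) : shiftZ 0 x = x := by
  funext t; simp [shiftZ]

theorem shiftMap_iter {A : Type} (n : ℕ) (x : ℤ → A) : shiftMap^[n] x = shiftZ n x := by
  induction n generalizing x with
  | zero => simp [shiftZ_zero']
  | succ n ih =>
    rw [Function.iterate_succ_apply, ih, show shiftMap x = shiftZ 1 x from rfl, shiftZ_shiftZ]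
    congr 1; push_cast; ring

theorem isAB_shift (x : ℤ → Fin 2) (d p : ℤ) : isAB (shiftZ d x) p ↔ isAB x (p + d) := by
  unfold isAB shiftZ
  simp only [add_right_comm p _ d]

theorem AB_iff (x : ℤ → Fin 2) : x ∈ Aset18 ∪ Bset18 ↔ x ∈ X18 ∧ isAB x 0 := by
  simp only [Aset18, Bset18, mem_union, mem_ofPred_eq, ← and_or_left]
  refine and_congr_right fun _ => ?_
  simp only [seqWord_succ, seqWord_zero, isAB]
  norm_num
  generalize x 6 = a
  generalize x 7 = b
  have : (a = 0 ∧ b = 1 ∨ a = 1 ∧ b = 0) ↔ b = 1 - a := by revert a b; decide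
  rw [← this]
  tauto

theorem mem_AB_iff (x : ℤ → Fin 2) (j : ℕ) : x ∈ shiftMap^[j] '' (Aset18 ∪ Bset18) ↔
    x ∈ X18 ∧ isAB x (-j) := by
  constructor
  · rintro ⟨y, hy, rfl⟩
    rw [AB_iff] at hy
    rw [shiftMap_iter, isAB_shift]
    exact ⟨shiftZ_mem hy.1 _, by simpa using hy.2⟩
  · rintro ⟨h1, h2⟩
    refine ⟨shiftZ (-j) x, ?_, ?_⟩
    · rw [AB_iff, isAB_shift]
      exact ⟨shiftZ_mem h1 _, by simpa using h2⟩
    · rw [shiftMap_iter, shiftZ_shiftZ, neg_add_cancel, shiftZ_zero']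

theorem mem_AB_iff' {x : ℤ → Fin 2} (hx : x ∈ X18) (j : ℕ) (hj : j ≤ 12) :
    x ∈ shiftMap^[j] '' (Aset18 ∪ Bset18) ↔ ph x % 12 = j % 12 := by
  rw [mem_AB_iff, isAB_Mt (ph_spec hx) le_rfl _ (by omega) (by omega)]
  constructor
  · rintro ⟨-, h⟩; omega
  · intro h; exact ⟨hx, by omega⟩

theorem jump_eq {x : ℤ → Fin 2} (hx : x ∈ X18) : (jump18 x : ℤ) = DD (ph x) 1 := by
  have h1 : (∃ j ∈ ({0, 1, 4, 5, 8, 9} : Set ℕ), x ∈ shiftMap^[j] '' (Aset18 ∪ Bset18)) ↔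
      (ph x % 4 = 0 ∨ ph x % 4 = 1) := by
    simp only [mem_insert_iff, mem_singleton_iff, exists_eq_or_imp, exists_eq_left]
    rw [mem_AB_iff' hx _ (by omega), mem_AB_iff' hx _ (by omega), mem_AB_iff' hx _ (by omega),
      mem_AB_iff' hx _ (by omega), mem_AB_iff' hx _ (by omega), mem_AB_iff' hx _ (by omega)]
    omega
  have h2 : (∃ j ∈ ({2, 6, 10} : Set ℕ), x ∈ shiftMap^[j] '' (Aset18 ∪ Bset18)) ↔
      (ph x % 4 = 2) := by
    simp only [mem_insert_iff, mem_singleton_iff, exists_eq_or_imp, exists_eq_left]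
    rw [mem_AB_iff' hx _ (by omega), mem_AB_iff' hx _ (by omega), mem_AB_iff' hx _ (by omega)]
    omega
  rw [jump18]
  simp only [h1, h2]
  unfold DD ee ii
  split_ifs <;> omega

/-- Integer powers of `S18`. -/
def Sn (n : ℤ) (x : ℤ → Fin 2) : ℤ → Fin 2 := shiftZ (DD (ph x) n) x

theorem Sn_mem {x : ℤ → Fin 2} (hx : x ∈ X18) (n : ℤ) : Sn n x ∈ X18 := shiftZ_mem hx _

theorem S_eq {x : ℤ → Fin 2} (hx : x ∈ X18) : S18 x = Sn 1 x := by
  rw [S18, shiftMap_iter, jump_eq hx]; rfl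

theorem Sn_zero (x : ℤ → Fin 2) : Sn 0 x = x := by
  rw [Sn, DD_zero, shiftZ_zero']

theorem Sn_Sn {x : ℤ → Fin 2} (hx : x ∈ X18) (a b : ℤ) : Sn b (Sn a x) = Sn (a + b) x := by
  have h : ph (Sn a x) % 12 = (ph x + DD (ph x) a) % 12 := ph_shift hx _
  rw [Sn, DD_congr (m' := ph x + DD (ph x) a) (by omega)]
  rw [Sn, shiftZ_shiftZ, ← DD_add]; rfl

theorem S_iter {x : ℤ → Fin 2} (hx : x ∈ X18) (n : ℕ) : S18^[n] x = Sn n x := by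
  induction n with
  | zero => simp [Sn_zero]
  | succ n ih =>
    rw [Function.iterate_succ_apply', ih, S_eq (Sn_mem hx _), Sn_Sn hx]; push_cast; rfl

theorem mem_orbit_S {x y : ℤ → Fin 2} (hx : x ∈ X18) :
    y ∈ orbitIn S18 X18 x ↔ ∃ n : ℤ, y = Sn n x := by
  constructor
  · rintro ⟨hy, n, h | h⟩
    · exact ⟨n, by rw [← h, S_iter hx]⟩
    · refine ⟨-n, ?_⟩
      rw [← h, S_iter hy, Sn_Sn hy, add_neg_cancel, Sn_zero]
  · rintro ⟨n, rfl⟩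
    refine ⟨Sn_mem hx _, ?_⟩
    obtain ⟨k, rfl | rfl⟩ := n.eq_nat_or_neg
    · exact ⟨k, Or.inl (S_iter hx k)⟩
    · refine ⟨k, Or.inr ?_⟩
      rw [S_iter (Sn_mem hx _), Sn_Sn hx, neg_add_cancel, Sn_zero]

theorem mem_orbit_shift {x y : ℤ → Fin 2} (c : ℕ)
    (h : y ∈ orbitIn (shiftMap^[c]) X18 x) : ∃ n : ℤ, y = shiftZ (c * n) x := by
  obtain ⟨hy, n, h | h⟩ := h
  · refine ⟨n, ?_⟩
    rw [← h, ← Function.iterate_mul, shiftMap_iter]; push_cast; rfl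
  · refine ⟨-n, ?_⟩
    rw [← h, ← Function.iterate_mul, shiftMap_iter, shiftZ_shiftZ]
    push_cast
    rw [mul_neg, add_neg_cancel, shiftZ_zero']

theorem shiftZ_mem_orbit {x : ℤ → Fin 2} (hx : x ∈ X18) (n : ℕ) :
    shiftZ n x ∈ orbitIn shiftMap X18 x := by
  exact ⟨shiftZ_mem hx _, n, Or.inl (shiftMap_iter n x)⟩

theorem shiftZ_inj {x : ℤ → Fin 2} (hx : x ∈ X18) {a b : ℤ} (h : shiftZ a x = shiftZ b x) :
    a = b := by
  have : shiftZ (a - b) x = x := by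
    have := congrArg (shiftZ (-b)) h
    rwa [shiftZ_shiftZ, shiftZ_shiftZ, add_neg_cancel, shiftZ_zero'] at this
  have := X_aper hx this
  omega

theorem orbit_number : OrbitNumberOn shiftMap S18 X18 2 := by
  intro x hx
  have h4 := shiftZ_mem hx 4
  have hph := ph_shift hx 4
  have hD : ∀ n, DD (ph (shiftZ 4 x)) n = DD (ph x) n := fun n => DD_congr (by omega) n
  refine ⟨![x, shiftZ 4 x], ?_, ?_, ?_⟩
  · intro i
    fin_cases i
    · have := shiftZ_mem_orbit hx 0
      simpa [shiftZ_zero'] using this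
    · exact shiftZ_mem_orbit hx 4
  · intro i j hij
    fin_cases i <;> fin_cases j
    · simp at hij
    · show shiftZ 4 x ∉ orbitIn S18 X18 x
      rw [mem_orbit_S hx]
      rintro ⟨n, hn⟩
      exact (DD_ne_four _ n).1 (shiftZ_inj hx hn).symm
    · show x ∉ orbitIn S18 X18 (shiftZ 4 x)
      rw [mem_orbit_S h4]
      rintro ⟨n, hn⟩
      rw [Sn, hD, shiftZ_shiftZ] at hn
      have := X_aper hx hn.symm
      exact (DD_ne_four (ph x) n).2 (by omega)
    · simp at hij
  · intro y hy
    obtain ⟨d, rfl⟩ := mem_orbit_shift 1 hy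
    rcases DD_hit (ph x) ((1 : ℕ) * d) with ⟨n, hn⟩ | ⟨n, hn⟩
    · refine ⟨0, ?_⟩
      show _ ∈ orbitIn S18 X18 x
      rw [mem_orbit_S hx]
      exact ⟨n, by rw [Sn, hn]⟩
    · refine ⟨1, ?_⟩
      show _ ∈ orbitIn S18 X18 (shiftZ 4 x)
      rw [mem_orbit_S h4]
      refine ⟨n, ?_⟩
      rw [Sn, hD, hn, shiftZ_shiftZ]
      congr 1; ring

theorem part1 (j1 j2 : ℕ) (h1 : j1 < 12) (h2 : j2 < 12) (hne : j1 ≠ j2) :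
    Disjoint (shiftMap^[j1] '' (Aset18 ∪ Bset18)) (shiftMap^[j2] '' (Aset18 ∪ Bset18)) := by
  rw [Set.disjoint_left]
  intro x hx hx'
  have hX := ((mem_AB_iff x j1).1 hx).1
  rw [mem_AB_iff' hX _ (by omega)] at hx hx'
  omega

theorem part2 : (⋃ j ∈ Finset.range 12, shiftMap^[j] '' (Aset18 ∪ Bset18)) = X18 := by
  ext x
  simp only [mem_iUnion, Finset.mem_range, exists_prop]
  constructor
  · rintro ⟨j, -, h⟩
    exact ((mem_AB_iff x j).1 h).1
  · intro hx
    refine ⟨(ph x % 12).toNat, by omega, ?_⟩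
    rw [mem_AB_iff' hx _ (by omega)]
    omega

/-! Topology -/

theorem cyl_nhds {B : Type} [TopologicalSpace B] [DiscreteTopology B] (x : ℤ → B) (N : ℤ) :
    {y : ℤ → B | ∀ t, -N ≤ t → t ≤ N → y t = x t} ∈ 𝓝 x := by
  have h : {y : ℤ → B | ∀ t, -N ≤ t → t ≤ N → y t = x t} =
      Set.pi (Set.Icc (-N) N) (fun t => {x t}) := by
    ext y; simp [Set.mem_pi]
  rw [h]
  exact set_pi_mem_nhds (Set.finite_Icc _ _) (fun t _ => by simp)

theorem mem_closure_iff_win (x : ℤ → Fin 2) (s : Set (ℤ → Fin 2)) :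
    x ∈ closure s ↔ ∀ N : ℕ, ∃ y ∈ s, ∀ t : ℤ, -N ≤ t → t ≤ N → y t = x t := by
  constructor
  · intro h N
    obtain ⟨y, hy1, hy2⟩ := mem_closure_iff_nhds.1 h _ (cyl_nhds x N)
    exact ⟨y, hy2, hy1⟩
  · intro h
    rw [mem_closure_iff]
    intro o ho hxo
    obtain ⟨I, u, hu, hsub⟩ := isOpen_pi_iff.1 ho x hxo
    obtain ⟨y, hy, hyx⟩ := h (I.sup Int.natAbs)
    refine ⟨y, hsub ?_, hy⟩
    intro t ht
    have hle : t.natAbs ≤ I.sup Int.natAbs := Finset.le_sup (f := Int.natAbs) ht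
    rw [hyx t (by omega) (by omega)]
    exact (hu t ht).2

theorem X_closed : IsClosed X18 := by
  rw [← closure_subset_iff_isClosed]
  intro x hx
  rw [mem_closure_iff_win] at hx
  rw [mem_X_iff]
  intro N
  obtain ⟨y, hy, h⟩ := hx N
  obtain ⟨m, hm⟩ := (mem_X_iff y).1 hy N
  exact ⟨m, fun t h1 h2 => by rw [← h t h1 h2, hm t h1 h2]⟩

theorem cont_of_win {β : Type} [TopologicalSpace β] (F : (ℤ → Fin 2) → β) (N : ℤ)
    (h : ∀ x ∈ X18, ∀ y ∈ X18, (∀ t, -N ≤ t → t ≤ N → y t = x t) → F y = F x) :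
    ContinuousOn F X18 := by
  intro x hx
  refine ContinuousWithinAt.congr_of_eventuallyEq (f := fun _ => F x) continuousWithinAt_const ?_ rfl
  filter_upwards [self_mem_nhdsWithin, mem_nhdsWithin_of_mem_nhds (cyl_nhds x N)] with y hy hy2
  exact h x hx y hy hy2

theorem jump_cont : ContinuousOn jump18 X18 := by
  refine cont_of_win _ 24 fun x hx y hy h => ?_
  have := ph_congr hx hy h
  have h1 := jump_eq hx
  have h2 := jump_eq hy
  rw [DD_congr (m' := ph x) (by omega), ← h1] at h2
  exact_mod_cast h2

theorem DD_bound (m n : ℤ) : |DD m n| ≤ 2 * |n| + 1 := by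
  have h1 := ee_range (ii m + n)
  have h2 := ee_range (ii m)
  unfold DD
  rcases abs_cases n with h | h <;> rw [abs_le] <;> constructor <;> omega

theorem Sn_win {x y : ℤ → Fin 2} (hx : x ∈ X18) (hy : y ∈ X18) (n : ℤ) (M : ℤ) (hM : 0 ≤ M)
    (h : ∀ t, -(25 + 2 * |n| + M) ≤ t → t ≤ 25 + 2 * |n| + M → y t = x t) :
    ∀ t, -M ≤ t → t ≤ M → Sn n y t = Sn n x t := by
  intro t h1 h2
  have hn := abs_nonneg n
  have hp := ph_congr hx hy (fun t h1 h2 => h t (by omega) (by omega))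
  have hb := abs_le.1 (DD_bound (ph x) n)
  rw [Sn, Sn, DD_congr (m' := ph x) (m := ph y) (by omega)]
  exact h _ (by omega) (by omega)

theorem Sn_cont (n : ℤ) : ContinuousOn (Sn n) X18 := by
  rw [continuousOn_pi]
  intro t
  refine cont_of_win _ (25 + 2 * |n| + |t|) fun x hx y hy h => ?_
  refine Sn_win hx hy n |t| (abs_nonneg t) h t (neg_abs_le t) (le_abs_self t)

theorem S_homeo : RestrictsToHomeomorph S18 X18 := by
  refine ⟨⟨⟨fun x => ⟨Sn 1 x, Sn_mem x.2 _⟩, fun x => ⟨Sn (-1) x, Sn_mem x.2 _⟩, ?_, ?_⟩, ?_, ?_⟩, ?_⟩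
  · intro x; ext1; simp [Sn_Sn x.2, Sn_zero]
  · intro x; ext1; simp [Sn_Sn x.2, Sn_zero]
  · exact ((Sn_cont 1).domRestrict).subtype_mk _
  · exact ((Sn_cont (-1)).domRestrict).subtype_mk _
  · intro x; exact (S_eq x.2).symm

theorem S_minimal : MinimalOn S18 X18 := by
  intro x hx y hy
  rw [mem_closure_iff_win]
  intro N
  obtain ⟨m', hm'⟩ := (mem_X_iff y).1 hy N
  obtain ⟨k, hk⟩ := vv_toep m' N
  have hk := hk k le_rfl
  obtain ⟨m, hm⟩ := (mem_X_iff x).1 hx (24 + N + 2 * (4 * 3 ^ k + 4) + 1)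
  have hk3 : ((3 ^ k : ℕ) : ℤ) = (3 : ℤ) ^ k := by push_cast; rfl
  obtain ⟨n, hn, q, hq⟩ := DD_reach m m' k
  have hp := ph_eq hx (by omega) hm
  refine ⟨Sn n x, (mem_orbit_S hx).2 ⟨n, rfl⟩, ?_⟩
  intro t h1 h2
  have hb := abs_le.1 (DD_bound m n)
  rw [abs_of_nonneg (by omega : (0 : ℤ) ≤ n)] at hb
  rw [Sn, DD_congr (m' := m) (by omega), shiftZ, hm _ (by omega) (by omega), hm' t h1 h2, ← hk q t h1 h2]
  congr 1
  linarith

theorem not_minimal_two : ¬ MinimalOn (shiftMap^[2]) X18 := by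
  intro h
  have h1 := h vv vv_mem (shiftZ_mem vv_mem 1)
  rw [mem_closure_iff_win] at h1
  obtain ⟨y, hy, hw⟩ := h1 24
  have hyX : y ∈ X18 := hy.1
  obtain ⟨n, rfl⟩ := mem_orbit_shift 2 hy
  have a1 := ph_congr (shiftZ_mem vv_mem 1) hyX hw
  have a2 := ph_shift vv_mem 1
  have a3 := ph_shift vv_mem ((2 : ℕ) * n)
  push_cast at a1 a3
  omega

theorem conj_minimal {α β : Type} [TopologicalSpace α] [TopologicalSpace β]
    {X : Set α} {S : α → α} {Y : Set β} {R : β → β} (hc : TopConj X S Y R)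
    (hm : MinimalOn S X) : MinimalOn R Y := by
  obtain ⟨hS, hR, h, hh⟩ := hc
  have hit : ∀ (n : ℕ) (x : X), ∃ hx : S^[n] x ∈ X, (h ⟨S^[n] x, hx⟩ : β) = R^[n] (h x) := by
    intro n x
    induction n with
    | zero => exact ⟨x.2, rfl⟩
    | succ n ih =>
      obtain ⟨hx, e⟩ := ih
      rw [Function.iterate_succ_apply', Function.iterate_succ_apply', ← e]
      exact ⟨hS hx, congrArg Subtype.val (hh ⟨_, hx⟩)⟩
  intro y hy y0 hy0
  have h1 := hm _ (h.symm ⟨y, hy⟩).2 (h.symm ⟨y0, hy0⟩).2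
  have h2 : h.symm ⟨y0, hy0⟩ ∈ closure ((↑) ⁻¹' orbitIn S X (h.symm ⟨y, hy⟩) : Set X) := by
    rw [closure_subtype, Subtype.image_preimage_coe, Set.inter_eq_right.2 (fun z hz => hz.1)]
    exact h1
  have h3 : Continuous (fun x : X => (h x : β)) := continuous_subtype_val.comp h.continuous
  have h4 := map_mem_closure h3 h2 (t := orbitIn R Y y) ?_
  · simpa using h4
  · intro z hz
    obtain ⟨-, n, e | e⟩ := hz
    · obtain ⟨hx, e2⟩ := hit n (h.symm ⟨y, hy⟩)
      refine ⟨(h z).2, n, Or.inl ?_⟩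
      have : (⟨_, hx⟩ : X) = z := Subtype.ext e
      rw [this] at e2
      simpa using e2.symm
    · obtain ⟨hx, e2⟩ := hit n z
      refine ⟨(h z).2, n, Or.inr ?_⟩
      have : (⟨_, hx⟩ : X) = h.symm ⟨y, hy⟩ := Subtype.ext e
      rw [this] at e2
      simpa using e2.symm

/-! The Toeplitz flow -/

theorem code_conj {B : Type} [TopologicalSpace B] [T2Space B] (code : (ℤ → Fin 2) → B)
    (hcode : ∀ x y : ℤ → Fin 2, code x = code y ↔ ∀ t, -24 ≤ t → t ≤ 24 → x t = y t) :
    IsToeplitz (fun n : ℤ => code (Sn n vv)) ∧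
    TopConj X18 S18 (orbitClosure (fun n : ℤ => code (Sn n vv))) shiftMap := by
  constructor
  · intro i
    obtain ⟨k, hk⟩ := vv_toep (DD (ph vv) i) 24
    have hk := hk k le_rfl
    refine ⟨4 * 3 ^ k, by positivity, fun q => ?_⟩
    rw [hcode]
    intro t h1 h2
    have := hk (2 * q) t (by exact_mod_cast h1) (by exact_mod_cast h2)
    simp only [Sn, shiftZ]
    push_cast
    rw [show i + q * (4 * 3 ^ k) = i + 4 * (q * 3 ^ k) by ring, DD_add_four, add_comm t (DD _ _),
      ← this]
    congr 1; ring
  · set H : (ℤ → Fin 2) → (ℤ → B) := fun x n => code (Sn n x) with hH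
    have Hcont : ContinuousOn H X18 := by
      rw [continuousOn_pi]
      intro n
      refine cont_of_win _ (25 + 2 * |n| + 24) fun x hx y hy h => ?_
      exact (hcode _ _).2 (Sn_win hx hy n 24 (by norm_num) h)
    have Heq : ∀ x ∈ X18, ∀ n, H (Sn n x) = shiftZ n (H x) := by
      intro x hx n
      funext k
      simp only [hH, shiftZ]
      rw [Sn_Sn hx, add_comm]
    have Hinj : Set.InjOn H X18 := by
      intro x hx y hy h
      have h' := fun n => (hcode _ _).1 (congrFun h n)
      have h0 := h' 0
      simp only [Sn_zero] at h0
      have hp := ph_congr hy hx h0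
      funext s
      have := h' (s / 2) (s - DD (ph y) (s / 2))
      have e1 := ee_range (ii (ph y) + s / 2)
      have e2 := ee_range (ii (ph y))
      have hd : DD (ph y) (s / 2) = 2 * (s / 2) + ee (ii (ph y) + s / 2) - ee (ii (ph y)) := rfl
      have := this (by omega) (by omega)
      rw [Sn, Sn, DD_congr (m := ph x) (m' := ph y) (by omega)] at this
      simpa [shiftZ] using this
    have Xc : IsCompact X18 := X_closed.isCompact
    have Himg : H '' X18 = orbitClosure (H vv) := by
      apply Set.Subset.antisymm
      · rintro _ ⟨x, hx, rfl⟩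
        have hcl := S_minimal vv vv_mem hx
        have hw : ContinuousWithinAt H (orbitIn S18 X18 vv) x :=
          (Hcont x hx).mono (fun z hz => hz.1)
        refine hw.mem_closure hcl ?_
        intro z hz
        obtain ⟨n, rfl⟩ := (mem_orbit_S vv_mem).1 hz
        exact ⟨n, (Heq vv vv_mem n).symm⟩
      · refine closure_minimal ?_ (Xc.image_of_continuousOn Hcont).isClosed
        rintro _ ⟨n, rfl⟩
        exact ⟨Sn n vv, Sn_mem vv_mem n, Heq vv vv_mem n⟩
    show TopConj X18 S18 (orbitClosure (H vv)) shiftMap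
    rw [← Himg]
    have HS : ∀ x ∈ X18, H (S18 x) = shiftMap (H x) := by
      intro x hx
      rw [S_eq hx, Heq x hx]; rfl
    have hSm : Set.MapsTo S18 X18 X18 := fun x hx => by rw [S_eq hx]; exact Sn_mem hx 1
    have : CompactSpace X18 := isCompact_iff_compactSpace.1 Xc
    let E : X18 ≃ (H '' X18 : Set (ℤ → B)) := Equiv.Set.imageOfInjOn H X18 Hinj
    have hE : Continuous E := (Hcont.domRestrict).subtype_mk _
    refine ⟨hSm, ?_, hE.homeoOfEquivCompactToT2, ?_⟩
    · rintro _ ⟨x, hx, rfl⟩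
      exact ⟨S18 x, hSm hx, HS x hx⟩
    · intro x
      apply Subtype.ext
      exact HS x x.2

theorem S_toeplitz : IsToeplitzFlow X18 S18 := by
  have key := @code_conj (Fin 49 → Fin 2) ⊥
    (@DiscreteTopology.toT2Space _ ⊥ (@DiscreteTopology.mk _ ⊥ rfl))
    (fun x i => x ((i : ℕ) - 24)) ?_
  · exact ⟨Fin 49 → Fin 2, inferInstance, _, key.1, key.2⟩
  · intro x y
    rw [funext_iff]
    constructor
    · intro h t h1 h2
      have := h ⟨(t + 24).toNat, by omega⟩
      simpa [Int.toNat_of_nonneg (by omega : 0 ≤ t + 24)] using this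
    · intro h i
      have := i.2
      exact h _ (by omega) (by omega)

/-- the sets σʲ(A ∪ B), 0 ≤ j ≤ 11, partition X (so p is well defined and
continuous); S is a homeomorphism of X with all orbits dense; the speedup has orbit
number 2; (X, S) is a Toeplitz flow; and σ² is not minimal on X, so (X, S) is not
conjugate to (X, σ²). -/
theorem statement18 :
    (∀ j1 j2 : ℕ, j1 < 12 → j2 < 12 → j1 ≠ j2 →
      Disjoint (shiftMap^[j1] '' (Aset18 ∪ Bset18)) (shiftMap^[j2] '' (Aset18 ∪ Bset18))) ∧
    (⋃ j ∈ Finset.range 12, shiftMap^[j] '' (Aset18 ∪ Bset18)) = X18 ∧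
    ContinuousOn jump18 X18 ∧
    RestrictsToHomeomorph S18 X18 ∧
    MinimalOn S18 X18 ∧
    OrbitNumberOn shiftMap S18 X18 2 ∧
    IsToeplitzFlow X18 S18 ∧
    ¬ MinimalOn (shiftMap^[2]) X18 ∧
    ¬ TopConj X18 S18 X18 (shiftMap^[2]) := by
  exact ⟨part1, part2, jump_cont, S_homeo, S_minimal, orbit_number, S_toeplitz, not_minimal_two,
    fun h => not_minimal_two (conj_minimal h S_minimal)⟩

end
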